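/- Let Y be a real random variable that is symmetric about the origin and whose characteristic function φ_Y is integrable on ℝ. Then for all real numbers a < b, E[Y · 1_{a ≤ Y ≤ b}] = (1/π) ∫₀^∞ ((bs·sin(bs) + cos(bs) − as·sin(as) − cos(as))/s²) φ_Y(s) ds. -/

import Mathlib

open MeasureTheory Complex
open Set Filter Topology FourierTransform SchwartzMap

/-- Parseval's identity for a finite measure tested against a Schwartz function. -/
lemma SchwartzMap.integral_eq_integral_fourier_mul_charFun (ν : Measure ℝ) [IsFiniteMeasure ν]
    (g : 𝓢(ℝ, ℂ)) :
    ∫ y, g y ∂ν = ∫ v, 𝓕 (g : ℝ → ℂ) v * charFun ν (2 * Real.pi * v) := by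
  set k : 𝓢(ℝ, ℂ) := 𝓕⁻ g with hk_def
  have h := VectorFourier.integral_fourierIntegral_smul_eq_flip (μ := volume) (ν := ν)
    (L := innerₗ ℝ) (f := k) (g := fun _ => (1 : ℂ)) Real.continuous_fourierChar
    continuous_inner k.integrable (integrable_const 1)
  have hinv : VectorFourier.fourierIntegral Real.fourierChar volume (innerₗ ℝ) k = g := by
    change ⇑(𝓕 k : 𝓢(ℝ, ℂ)) = g
    rw [hk_def, FourierTransform.fourier_fourierInv_eq]
  simp only [hinv, smul_eq_mul, mul_one] at h
  rw [h, ← integral_neg_eq_self]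
  congr with v
  rw [hk_def, fourierInv_coe, Real.fourierInv_eq_fourier_neg, neg_neg]
  congr 1
  rw [charFun_apply_real, VectorFourier.fourierIntegral]
  congr with y
  simp [Circle.smul_def, Real.fourierChar_apply]
  ring_nf

/-- The Fourier transform is self-adjoint on integrable functions. -/
lemma integral_fourier_mul_eq_integral_mul_fourier {f g : ℝ → ℂ} (hf : Integrable f)
    (hg : Integrable g) : ∫ v, 𝓕 f v * g v = ∫ x, f x * 𝓕 g x := by
  simpa using! VectorFourier.integral_fourierIntegral_smul_eq_flip (L := innerₗ ℝ)
    Real.continuous_fourierChar continuous_inner hf hg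

lemma continuous_fourier_of_integrable {f : ℝ → ℂ} (hf : Integrable f) : Continuous (𝓕 f) :=
  VectorFourier.fourierIntegral_continuous Real.continuous_fourierChar continuous_inner hf

/-- Fourier inversion for a measure with integrable characteristic function, integrated against
a smooth function over a compact interval. -/
lemma setIntegral_Icc_eq_integral_fourier_mul_charFun (ν : Measure ℝ) [IsFiniteMeasure ν]
    (hν : Integrable (charFun ν)) {p : ℝ → ℂ} (hp : ContDiff ℝ (⊤ : ℕ∞) p) {a b : ℝ}
    (hab : a < b) :
    ∫ y in Icc a b, p y ∂ν =
      ∫ v, 𝓕 ((Icc a b).indicator p) v * charFun ν (2 * Real.pi * v) := by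
  have hΦ : Integrable fun v => charFun ν (2 * Real.pi * v) :=
    hν.comp_mul_left' (by positivity)
  set Φ : ℝ → ℂ := fun v => charFun ν (2 * Real.pi * v)
  have hpI (c d : ℝ) (m : Measure ℝ) [IsFiniteMeasureOnCompacts m] :
      Integrable ((Icc c d).indicator p) m :=
    (hp.continuous.continuousOn.integrableOn_compact isCompact_Icc).integrable_indicator
      measurableSet_Icc
  rw [integral_fourier_mul_eq_integral_mul_fourier (hpI a b _) hΦ,
    ← integral_indicator measurableSet_Icc]
  let ψ (n : ℕ) : ContDiffBump ((a + b) / 2) :=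
    { rIn := (b - a) / 2
      rOut := (b - a) / 2 + 1 / ((n : ℝ) + 1)
      rIn_pos := by linarith
      rIn_lt_rOut := by simp; positivity }
  let g (n : ℕ) (x : ℝ) : ℂ := ψ n x * p x
  have hgs (n : ℕ) : ContDiff ℝ (⊤ : ℕ∞) (g n) :=
    (ofRealCLM.contDiff.comp (ψ n).contDiff).mul hp
  have hgc (n : ℕ) : HasCompactSupport (g n) :=
    HasCompactSupport.mul_right ((ψ n).hasCompactSupport.comp_left ofReal_zero)
  have hg_le (n : ℕ) (x : ℝ) : ‖g n x‖ ≤ ‖(Icc (a - 1) (b + 1)).indicator p x‖ := by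
    by_cases hx : x ∈ Icc (a - 1) (b + 1)
    · rw [indicator_of_mem hx, norm_mul, norm_real, Real.norm_of_nonneg (ψ n).nonneg]
      exact mul_le_of_le_one_left (norm_nonneg _) (ψ n).le_one
    · have : ψ n x = 0 := by
        apply (ψ n).zero_of_le_dist
        have h1 : (1 : ℝ) / (n + 1) ≤ 1 := by
          rw [div_le_one (by positivity)]; linarith [n.cast_nonneg (α := ℝ)]
        simp only [mem_Icc, not_and_or, not_le] at hx
        simp only [ψ, Real.dist_eq]
        rcases hx with hx | hx
        · linarith [neg_abs_le (x - (a + b) / 2)]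
        · linarith [le_abs_self (x - (a + b) / 2)]
      simp [g, this]
  have hg_lim (x : ℝ) : Tendsto (fun n => g n x) atTop (𝓝 ((Icc a b).indicator p x)) := by
    by_cases hx : x ∈ Icc a b
    · have (n : ℕ) : ψ n x = 1 := by
        apply (ψ n).one_of_mem_closedBall
        rw [Metric.mem_closedBall, Real.dist_eq, abs_le]
        constructor <;> simp only [ψ] <;> linarith [hx.1, hx.2]
      simp [g, this, hx]
    · have hd : 0 < |x - (a + b) / 2| - (b - a) / 2 := by
        simp only [mem_Icc, not_and_or, not_le] at hx
        rcases hx with hx | hx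
        · linarith [neg_abs_le (x - (a + b) / 2)]
        · linarith [le_abs_self (x - (a + b) / 2)]
      rw [indicator_of_notMem hx]
      refine tendsto_const_nhds.congr' ?_
      filter_upwards [tendsto_one_div_add_atTop_nhds_zero_nat.eventually (gt_mem_nhds hd)]
        with n hn
      have : ψ n x = 0 := by
        apply (ψ n).zero_of_le_dist
        simp only [ψ, Real.dist_eq]
        linarith
      simp [g, this]
  have hcont : Continuous (𝓕 Φ) := continuous_fourier_of_integrable hΦ
  have hbdd : ∀ x, ‖𝓕 Φ x‖ ≤ ∫ v, ‖Φ v‖ :=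
    VectorFourier.norm_fourierIntegral_le_integral_norm _ _ _ _
  have hL : Tendsto (fun n => ∫ y, g n y ∂ν) atTop (𝓝 (∫ y, (Icc a b).indicator p y ∂ν)) :=
    tendsto_integral_of_dominated_convergence _
      (fun n => (hgs n).continuous.aestronglyMeasurable) (hpI (a - 1) (b + 1) ν).norm
      (fun n => ae_of_all _ (hg_le n)) (ae_of_all _ hg_lim)
  have hR : Tendsto (fun n => ∫ x, g n x * 𝓕 Φ x) atTop
      (𝓝 (∫ x, (Icc a b).indicator p x * 𝓕 Φ x)) := by
    refine tendsto_integral_of_dominated_convergence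
      (fun x => ‖(Icc (a - 1) (b + 1)).indicator p x‖ * ∫ v, ‖Φ v‖)
      (fun n => ((hgs n).continuous.mul hcont).aestronglyMeasurable)
      ((hpI (a - 1) (b + 1) volume).norm.mul_const _)
      (fun n => ae_of_all _ fun x => ?_) (ae_of_all _ fun x => (hg_lim x).mul_const _)
    rw [norm_mul]
    exact mul_le_mul (hg_le n x) (hbdd x) (norm_nonneg _) (norm_nonneg _)
  refine tendsto_nhds_unique hL (hR.congr fun n => ?_)
  exact (integral_fourier_mul_eq_integral_mul_fourier
    ((hgc n).toSchwartzMap (hgs n)).integrable hΦ).symm.trans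
      (((hgc n).toSchwartzMap (hgs n)).integral_eq_integral_fourier_mul_charFun ν).symm

/-- An integrable function on the line can be folded onto the positive half-line. -/
lemma integral_eq_setIntegral_Ioi_add_comp_neg {G : ℝ → ℂ} (hG : Integrable G) :
    ∫ s, G s = ∫ s in Ioi (0 : ℝ), (G s + G (-s)) := by
  rw [integral_add hG.integrableOn hG.comp_neg.integrableOn, integral_comp_neg_Ioi, neg_zero,
    add_comm, intervalIntegral.integral_Iic_add_Ioi hG.integrableOn hG.integrableOn]

lemma intervalIntegral_mul_cos {s : ℝ} (hs : s ≠ 0) (a b : ℝ) :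
    ∫ x in a..b, x * Real.cos (s * x) =
      (b * s * Real.sin (b * s) + Real.cos (b * s)
        - a * s * Real.sin (a * s) - Real.cos (a * s)) / s ^ 2 := by
  have hderiv (x : ℝ) : HasDerivAt
      (fun x => (x * s * Real.sin (x * s) + Real.cos (x * s)) / s ^ 2)
      (x * Real.cos (s * x)) x := by
    have h1 : HasDerivAt (fun x : ℝ => x * s) s x := by simpa using (hasDerivAt_id x).mul_const s
    convert! ((h1.mul h1.sin).add h1.cos).div_const (s ^ 2) using 1
    rw [mul_comm s x]
    field_simp
    ring
  rw [intervalIntegral.integral_eq_sub_of_hasDerivAt (fun x _ => hderiv x)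
    (Continuous.intervalIntegrable (by fun_prop) _ _)]
  ring

lemma fourier_indicator_Icc_add_comp_neg {s a b : ℝ} (hs : s ≠ 0) (hab : a ≤ b) :
    𝓕 ((Icc a b).indicator fun x : ℝ => (x : ℂ)) (s / (2 * Real.pi)) +
        𝓕 ((Icc a b).indicator fun x : ℝ => (x : ℂ)) (-s / (2 * Real.pi)) =
      2 * (((b * s * Real.sin (b * s) + Real.cos (b * s)
        - a * s * Real.sin (a * s) - Real.cos (a * s)) / s ^ 2 : ℝ) : ℂ) := by
  have h (t : ℝ) : 𝓕 ((Icc a b).indicator fun x : ℝ => (x : ℂ)) (t / (2 * Real.pi)) =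
      ∫ x in a..b, exp (-(t * x) * I) * x := by
    rw [Real.fourier_real_eq_integral_exp_smul, intervalIntegral.integral_of_le hab,
      ← integral_Icc_eq_integral_Ioc, ← integral_indicator measurableSet_Icc]
    congr with x
    by_cases hx : x ∈ Icc a b
    · rw [indicator_of_mem hx, indicator_of_mem hx, smul_eq_mul]
      congr 3
      push_cast
      field_simp
    · simp [hx]
  rw [← intervalIntegral_mul_cos hs, h, h, ← intervalIntegral.integral_ofReal,
    ← intervalIntegral.integral_add (Continuous.intervalIntegrable (by fun_prop) _ _)
      (Continuous.intervalIntegrable (by fun_prop) _ _), ← intervalIntegral.integral_const_mul]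
  congr with x
  push_cast
  rw [Complex.cos]
  ring_nf

/-- The truncated mean of a symmetric law with integrable characteristic function. -/
lemma setIntegral_Icc_id_eq_of_charFun_even (ν : Measure ℝ) [IsFiniteMeasure ν]
    (hν : Integrable (charFun ν)) (heven : ∀ s, charFun ν (-s) = charFun ν s) {a b : ℝ}
    (hab : a < b) :
    ∫ y in Icc a b, (y : ℂ) ∂ν =
      (1 / Real.pi) * ∫ s in Ioi (0 : ℝ),
        (((b * s * Real.sin (b * s) + Real.cos (b * s)
          - a * s * Real.sin (a * s) - Real.cos (a * s)) / s ^ 2 : ℝ) : ℂ) * charFun ν s := by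
  refine (setIntegral_Icc_eq_integral_fourier_mul_charFun ν hν ofRealCLM.contDiff hab).trans ?_
  set q : ℝ → ℂ := (Icc a b).indicator fun x : ℝ => (x : ℂ)
  change ∫ v, 𝓕 q v * _ = _
  have hq : Integrable q :=
    (continuous_ofReal.continuousOn.integrableOn_compact isCompact_Icc).integrable_indicator
      measurableSet_Icc
  have hG : Integrable fun s => 𝓕 q (s / (2 * Real.pi)) * charFun ν s :=
    hν.bdd_mul (c := ∫ x, ‖q x‖)
      ((continuous_fourier_of_integrable hq).comp (by fun_prop)).aestronglyMeasurable
      (ae_of_all _ fun s => VectorFourier.norm_fourierIntegral_le_integral_norm _ _ _ _ _)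
  have hscale := Measure.integral_comp_mul_left
    (fun s => 𝓕 q (s / (2 * Real.pi)) * charFun ν s) (2 * Real.pi)
  have hpi : 2 * Real.pi ≠ 0 := by positivity
  simp only [mul_div_cancel_left₀ _ hpi] at hscale
  rw [hscale, integral_eq_setIntegral_Ioi_add_comp_neg hG, abs_of_pos (by positivity),
    real_smul, ← integral_const_mul, ← integral_const_mul]
  refine setIntegral_congr_fun measurableSet_Ioi fun s hs => ?_
  have hs0 : s ≠ 0 := ne_of_gt hs
  simp only [heven, ← add_mul]
  rw [fourier_indicator_Icc_add_comp_neg hs0 hab.le]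
  push_cast
  field_simp

/-- **Truncated-mean formula for symmetric random variables.**
If `Y` is a real random variable, symmetric about the origin, whose characteristic
function `φ_Y` is integrable on `ℝ`, then for all `a < b`,
`E[Y 1_{a ≤ Y ≤ b}] = (1/π) ∫₀^∞ ((b s sin(b s) + cos(b s) - a s sin(a s) - cos(a s))/s²) φ_Y(s) ds`. -/
theorem truncated_mean_of_symmetric_integrable_charFun
    {Ω : Type*} [MeasurableSpace Ω] (μ : Measure Ω) [IsProbabilityMeasure μ]
    (Y : Ω → ℝ) (hY : Measurable Y)
    (φY : ℝ → ℂ)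
    (hφY : ∀ s : ℝ, φY s = ∫ ω, Complex.exp (Complex.I * (s * Y ω)) ∂μ)
    (hsymm : Measure.map Y μ = Measure.map (fun ω => -Y ω) μ)
    (hint : Integrable φY) :
    ∀ a b : ℝ, a < b →
      ((∫ ω, Set.indicator {ω | a ≤ Y ω ∧ Y ω ≤ b} Y ω ∂μ : ℝ) : ℂ) =
        (1 / Real.pi) * ∫ s in Set.Ioi (0 : ℝ),
          (((b * s * Real.sin (b * s) + Real.cos (b * s)
              - a * s * Real.sin (a * s) - Real.cos (a * s)) / s ^ 2 : ℝ) : ℂ) * φY s := by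
  intro a b hab
  have hφ : φY = charFun (μ.map Y) := by
    ext s
    rw [hφY, charFun_apply_real, integral_map hY.aemeasurable (by fun_prop)]
    congr with ω
    ring_nf
  have heven (s : ℝ) : charFun (μ.map Y) (-s) = charFun (μ.map Y) s := by
    conv_rhs => rw [hsymm]
    rw [charFun_apply_real, charFun_apply_real, integral_map hY.aemeasurable (by fun_prop),
      integral_map hY.fun_neg.aemeasurable (by fun_prop)]
    simp
  subst hφ
  rw [← setIntegral_Icc_id_eq_of_charFun_even _ hint heven hab, integral_complex_ofReal,
    setIntegral_map measurableSet_Icc (by fun_prop) hY.aemeasurable,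
    ← integral_indicator (hY measurableSet_Icc)]
  rfl
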